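/- For all ordinals α and β, the set of ordinals γ such that γ is an instance of a sum of α and β is finite. -/

import Mathlib

universe u

/-- `γ` is an *instance of a sum* of `α` and `β`: the set of ordinals below `γ` can be
partitioned into two subsets whose induced orders have order types `α` and `β`
(equivalently, are order-isomorphic to the sets of ordinals below `α` resp. `β`). -/
def IsSumInstance (γ α β : Ordinal.{u}) : Prop :=
  ∃ s : Set Ordinal.{u}, s ⊆ Set.Iio γ ∧
    Nonempty (↥s ≃o ↥(Set.Iio α)) ∧ Nonempty (↥(Set.Iio γ \ s) ≃o ↥(Set.Iio β))

open Ordinal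

/-- A well order of type `γ` has a subset of type `α` whose complement has type `β`. -/
def IsTypeSplit (γ α β : Ordinal.{u}) : Prop :=
  ∃ p : γ.ToType → Prop, type (Subrel (α := γ.ToType) (· < ·) p) = α ∧
    type (Subrel (α := γ.ToType) (· < ·) fun x => ¬ p x) = β

theorem type_subrel_comp_relIso {X Y : Type u} {r : X → X → Prop} {s : Y → Y → Prop}
    [IsWellOrder X r] [IsWellOrder Y s] (e : r ≃r s) (p : Y → Prop) :
    type (Subrel r fun x => p (e x)) = type (Subrel s p) :=
  type_eq.2 ⟨⟨e.toEquiv.subtypeEquiv fun _ => Iff.rfl, e.map_rel_iff⟩⟩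

theorem type_subrel_sumLex {X Y : Type u} (r : X → X → Prop) (s : Y → Y → Prop)
    [IsWellOrder X r] [IsWellOrder Y s] (p : X ⊕ Y → Prop) :
    type (Subrel (Sum.Lex r s) p) =
      type (Subrel r fun x => p (Sum.inl x)) + type (Subrel s fun y => p (Sum.inr y)) := by
  rw [← type_sum_lex]
  refine type_eq.2 ⟨⟨Equiv.subtypeSum, ?_⟩⟩
  rintro ⟨a | a, ha⟩ ⟨b | b, hb⟩ <;> simp [Equiv.subtypeSum, Subrel]

theorem type_subrel_le {X : Type u} (r : X → X → Prop) [IsWellOrder X r] (p : X → Prop) :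
    type (Subrel r p) ≤ type r :=
  type_le_iff'.2 ⟨Subrel.relEmbedding r p⟩

theorem IsTypeSplit.of_type {X : Type u} (r : X → X → Prop) [IsWellOrder X r] (p : X → Prop) :
    IsTypeSplit (type r) (type (Subrel r p)) (type (Subrel r fun x => ¬ p x)) := by
  obtain ⟨e⟩ := type_eq.1 (type_toType (type r))
  exact ⟨fun x => p (e x), type_subrel_comp_relIso e p, type_subrel_comp_relIso e fun x => ¬ p x⟩

theorem IsTypeSplit.exists_pred {γ α β : Ordinal.{u}} (h : IsTypeSplit γ α β) {X : Type u}
    (r : X → X → Prop) [IsWellOrder X r] (hr : type r = γ) :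
    ∃ p : X → Prop, type (Subrel r p) = α ∧ type (Subrel r fun x => ¬ p x) = β := by
  obtain ⟨p, rfl, rfl⟩ := h
  obtain ⟨e⟩ := type_eq.1 (hr.trans (type_toType γ).symm)
  exact ⟨fun x => p (e x), type_subrel_comp_relIso e p, type_subrel_comp_relIso e fun x => ¬ p x⟩

theorem IsTypeSplit.left_le {γ α β : Ordinal.{u}} (h : IsTypeSplit γ α β) : α ≤ γ := by
  obtain ⟨p, rfl, -⟩ := h
  exact (type_subrel_le _ _).trans_eq (type_toType γ)

theorem IsTypeSplit.right_le {γ α β : Ordinal.{u}} (h : IsTypeSplit γ α β) : β ≤ γ := by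
  obtain ⟨p, -, rfl⟩ := h
  exact (type_subrel_le _ _).trans_eq (type_toType γ)

/-- Cutting a split well order into an initial and a final segment splits both segments. -/
theorem IsTypeSplit.of_add {γ₁ γ₂ α β : Ordinal.{u}} (h : IsTypeSplit (γ₁ + γ₂) α β) :
    ∃ α₁ α₂ β₁ β₂, α₁ + α₂ = α ∧ β₁ + β₂ = β ∧
      IsTypeSplit γ₁ α₁ β₁ ∧ IsTypeSplit γ₂ α₂ β₂ := by
  obtain ⟨p, rfl, rfl⟩ := h.exists_pred
    (Sum.Lex ((· < ·) : γ₁.ToType → γ₁.ToType → Prop) ((· < ·) : γ₂.ToType → γ₂.ToType → Prop))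
    (by rw [type_sum_lex, type_toType, type_toType])
  exact ⟨_, _, _, _, (type_subrel_sumLex _ _ p).symm,
    (type_subrel_sumLex _ _ fun x => ¬ p x).symm, ⟨_, rfl, rfl⟩, ⟨_, rfl, rfl⟩⟩

theorem IsSumInstance.isTypeSplit {γ α β : Ordinal.{u}} (h : IsSumInstance γ α β) :
    IsTypeSplit γ α β := by
  obtain ⟨s, hs, ⟨e⟩, ⟨f⟩⟩ := h
  refine ⟨fun x => (ToType.mk.symm x : Ordinal) ∈ s, ?_, ?_⟩
  · rw [← type_toType α]
    let g : {x : γ.ToType // (ToType.mk.symm x : Ordinal) ∈ s} ≃ s :=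
      { toFun := fun x => ⟨_, x.2⟩
        invFun := fun y => ⟨ToType.mk ⟨y, hs y.2⟩, by simp⟩
        left_inv := fun x => by simp
        right_inv := fun y => by simp }
    have hg : ∀ a b, g a < g b ↔ a < b := fun a b => ToType.mk.symm.lt_iff_lt
    refine type_eq.2 ⟨⟨g.trans (e.toEquiv.trans ToType.mk.toEquiv), ?_⟩⟩
    intro a b
    exact (ToType.mk.lt_iff_lt.trans e.lt_iff_lt).trans (hg a b)
  · rw [← type_toType β]
    let g : {x : γ.ToType // (ToType.mk.symm x : Ordinal) ∉ s} ≃ ↥(Set.Iio γ \ s) :=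
      { toFun := fun x => ⟨_, (ToType.mk.symm x.1).2, x.2⟩
        invFun := fun y => ⟨ToType.mk ⟨y, y.2.1⟩, by simpa using y.2.2⟩
        left_inv := fun x => by simp
        right_inv := fun y => by simp }
    have hg : ∀ a b, g a < g b ↔ a < b := fun a b => ToType.mk.symm.lt_iff_lt
    refine type_eq.2 ⟨⟨g.trans (f.toEquiv.trans ToType.mk.toEquiv), ?_⟩⟩
    intro a b
    exact (ToType.mk.lt_iff_lt.trans f.lt_iff_lt).trans (hg a b)

theorem IsTypeSplit.exists_of_le {δ γ α β : Ordinal.{u}} (h : IsTypeSplit γ α β) (hδ : δ ≤ γ) :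
    ∃ α' ≤ α, ∃ β' ≤ β, IsTypeSplit δ α' β' := by
  rw [← Ordinal.add_sub_cancel_of_le hδ] at h
  obtain ⟨α₁, α₂, β₁, β₂, rfl, rfl, h₁, -⟩ := h.of_add
  exact ⟨α₁, le_self_add, β₁, le_self_add, h₁⟩

theorem IsTypeSplit.exists_mul_natCast_le {δ : Ordinal.{u}}
    (hδ : ∀ α β, IsTypeSplit δ α β → δ ≤ α ∨ δ ≤ β) (k : ℕ) {α β : Ordinal.{u}}
    (h : IsTypeSplit (δ * k) α β) : ∃ n m : ℕ, n + m = k ∧ δ * n ≤ α ∧ δ * m ≤ β := by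
  induction k generalizing α β with
  | zero => exact ⟨0, 0, by simp⟩
  | succ k ih =>
    rw [Nat.cast_succ, mul_add_one] at h
    obtain ⟨α₁, α₂, β₁, β₂, rfl, rfl, h₁, h₂⟩ := h.of_add
    obtain ⟨n, m, rfl, hn, hm⟩ := ih h₁
    obtain h | h := hδ _ _ h₂
    · refine ⟨n + 1, m, by omega, ?_, hm.trans le_self_add⟩
      rw [Nat.cast_succ, mul_add_one]
      exact add_le_add hn h
    · refine ⟨n, m + 1, by omega, hn.trans le_self_add, ?_⟩
      rw [Nat.cast_succ, mul_add_one]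
      exact add_le_add hm h

/-- Powers of `ω` are indecomposable: one part of any splitting has full type. -/
theorem IsTypeSplit.omega0_opow_le {e α β : Ordinal.{u}} (h : IsTypeSplit (ω ^ e) α β) :
    ω ^ e ≤ α ∨ ω ^ e ≤ β := by
  induction e using WellFoundedLT.induction generalizing α β with
  | ind e ih =>
    by_contra! hlt
    obtain ⟨hα, hβ⟩ := hlt
    obtain rfl | he := eq_or_ne e 0
    · rw [opow_zero] at h hα hβ
      obtain ⟨p, rfl, rfl⟩ := h
      rw [Order.lt_one_iff, type_eq_zero_iff_isEmpty] at hα hβ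
      have x : (1 : Ordinal.{u}).ToType := ToType.mk ⟨0, Set.mem_Iio.2 zero_lt_one⟩
      by_cases hx : p x
      · exact hα.false ⟨x, hx⟩
      · exact hβ.false ⟨x, hx⟩
    obtain ⟨c, hc, n, hn⟩ : ∃ c < e, ∃ n : ℕ, max α β < ω ^ c * n :=
      (lt_omega0_opow he).1 (max_lt hα hβ)
    obtain ⟨α', hα', β', hβ', h'⟩ := h.exists_of_le
      (opow_mul_lt_opow (natCast_lt_omega0 (n + n)) hc).le
    obtain ⟨k, m, hkm, hk, hm⟩ := h'.exists_mul_natCast_le (fun _ _ => ih c hc)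
    have key {j : ℕ} (hj : ω ^ c * j ≤ max α β) : j < n := by
      have := lt_of_mul_lt_mul_left' (hj.trans_lt hn)
      exact_mod_cast this
    have := key (hk.trans (hα'.trans (le_max_left _ _)))
    have := key (hm.trans (hβ'.trans (le_max_right _ _)))
    omega

theorem finite_setOf_exists_add_eq (c : Ordinal.{u}) :
    {b : Ordinal.{u} | ∃ a, a + b = c}.Finite := by
  have hex (b : {b : Ordinal.{u} | ∃ a, a + b = c}) : ∃ a, a + b.1 = c := b.2
  choose f hf using hex
  have hanti : StrictAnti f := by
    intro b b' hb
    by_contra! hle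
    have := (add_lt_add_right (Subtype.coe_lt_coe.2 hb) (f b)).trans_le (add_le_add_left hle b'.1)
    rw [hf, hf] at this
    exact this.false
  have := hanti.wellFoundedGT
  exact Finite.of_wellFoundedLT_wellFoundedGT {b : Ordinal.{u} | ∃ a, a + b = c}

theorem IsTypeSplit.eq_log {γ α β : Ordinal.{u}} (hγ : γ ≠ 0) (h : IsTypeSplit γ α β) :
    log ω γ = log ω (max α β) := by
  apply le_antisymm
  · obtain ⟨α', hα', β', hβ', h'⟩ := h.exists_of_le (opow_log_le_self ω hγ)
    have hle : ω ^ log ω γ ≤ max α β :=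
      h'.omega0_opow_le.elim (fun h => h.trans (hα'.trans (le_max_left _ _)))
        fun h => h.trans (hβ'.trans (le_max_right _ _))
    exact (opow_le_iff_le_log one_lt_omega0
      ((opow_pos _ omega0_pos).trans_le hle).ne').1 hle
  · exact log_mono_right _ (max_le h.left_le h.right_le)

theorem not_omega0_opow_log_add_le {γ α : Ordinal.{u}} (hα : α ≤ γ) :
    ¬ ω ^ log ω γ + α ≤ α := by
  rw [add_le_right_iff_mul_omega0_le, not_le, ← opow_succ]
  exact hα.trans_lt (lt_opow_succ_log_self one_lt_omega0 γ)

/-- Removing the leading power of `ω` from a split well order leaves a strictly smaller pair of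
parts, each of them a remainder of the original one. -/
theorem IsTypeSplit.exists_lt {γ α β : Ordinal.{u}} (hγ : γ ≠ 0) (h : IsTypeSplit γ α β) :
    ∃ α' β' γ', (∃ a, a + α' = α) ∧ (∃ b, b + β' = β) ∧ (α', β') < (α, β) ∧
      IsTypeSplit γ' α' β' ∧ ω ^ log ω (max α β) + γ' = γ := by
  have hadd := Ordinal.add_sub_cancel_of_le (opow_log_le_self ω hγ)
  have hlog := h.eq_log hγ
  have hα := not_omega0_opow_log_add_le h.left_le
  have hβ := not_omega0_opow_log_add_le h.right_le
  have h' := h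
  rw [← hadd] at h'
  obtain ⟨α₁, α₂, β₁, β₂, rfl, rfl, h₁, h₂⟩ := h'.of_add
  refine ⟨α₂, β₂, _, ⟨α₁, rfl⟩, ⟨β₁, rfl⟩, ?_, h₂, by rw [← hlog, hadd]⟩
  refine lt_of_le_of_ne ⟨le_add_self, le_add_self⟩ fun heq => ?_
  obtain ⟨ha, hb⟩ := Prod.mk.inj heq
  rw [← ha] at hα
  rw [← hb] at hβ
  obtain hle | hle := h₁.omega0_opow_le
  · exact hα ((add_le_add_left hle α₂).trans_eq ha.symm)
  · exact hβ ((add_le_add_left hle β₂).trans_eq hb.symm)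

theorem finite_setOf_isTypeSplit (q : Ordinal.{u} × Ordinal.{u}) :
    {γ | IsTypeSplit γ q.1 q.2}.Finite := by
  induction q using WellFoundedLT.induction with
  | ind q ih =>
    obtain ⟨α, β⟩ := q
    have hfin : {q : Ordinal.{u} × Ordinal.{u} |
        ((∃ a, a + q.1 = α) ∧ ∃ b, b + q.2 = β) ∧ q < (α, β)}.Finite :=
      ((finite_setOf_exists_add_eq α).prod (finite_setOf_exists_add_eq β)).subset
        fun q hq => hq.1
    refine ((hfin.biUnion fun q hq =>
      (ih q hq.2).image (ω ^ log ω (max α β) + ·)).insert 0).subset fun γ hγ => ?_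
    obtain rfl | h0 := eq_or_ne γ 0
    · exact Set.mem_insert _ _
    obtain ⟨α', β', γ', hα, hβ, hlt, hs, rfl⟩ := IsTypeSplit.exists_lt h0 hγ
    exact Set.mem_insert_of_mem _
      (Set.mem_biUnion (x := (α', β')) ⟨⟨hα, hβ⟩, hlt⟩ ⟨γ', hs, rfl⟩)

/-- For any ordinals `α` and `β` there are only finitely many instances of a sum of `α`
and `β`. -/
theorem finitely_many_sum_instances (α β : Ordinal.{u}) :
    {γ : Ordinal.{u} | IsSumInstance γ α β}.Finite :=
  (finite_setOf_isTypeSplit (α, β)).subset fun _ h => h.isTypeSplit
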